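/- Let V = ⊕_{i≥0} V_i be a graded vector space over a field k with each V_i finite-dimensional and V_i = 0 for i > 2d, and let φ = ⊕φ_i be a graded endomorphism. Give V^{⊗n} the Koszul-sign action of S_n (transposing adjacent homogeneous factors of degrees a, b introduces the sign (-1)^{ab}). Then for any σ ∈ S_n, the graded Lefschetz series satisfies L_u(σ ∘ φ^{⊗n}) = Π_{r=1}^{n} L_{u^r}(φ^r)^{m_r(σ)}, where L_u(ψ) = Σ_{i≥0} (-u)^i Tr(ψ_i) and m_r(σ) is the number of r-cycles of σ. -/

import Mathlib

open DirectSum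

def cycleCount {n : ℕ} (g : Equiv.Perm (Fin n)) (r : ℕ) : ℕ :=
  if r = 1 then (Finset.univ.filter fun i => g i = i).card
  else Multiset.count r g.cycleType

variable (k : Type*) [Field k] (V : ℕ → Type*) [∀ i, AddCommGroup (V i)] [∀ i, Module k (V i)]

/-- The `n`-fold tensor power of the graded vector space `V = ⊕_i V i`, decomposed over
degree functions `f : Fin n → ℕ`: `V^{⊗n} = ⊕_f (V (f 1) ⊗ ⋯ ⊗ V (f n))`. -/
abbrev GT (n : ℕ) : Type _ :=
  ⨁ f : Fin n → ℕ, PiTensorProduct k fun j => V (f j)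

/-- `Q_σ(f) = Σ_{i<j, σ(i)>σ(j)} f i * f j`, the exponent of the Koszul sign. -/
def Qnum {n : ℕ} (σ : Equiv.Perm (Fin n)) (f : Fin n → ℕ) : ℕ :=
  ∑ p ∈ Finset.univ.filter (fun p : Fin n × Fin n => p.1 < p.2 ∧ σ p.2 < σ p.1),
    f p.1 * f p.2

/-- `σ ∘ φ^{⊗n}` on `V^{⊗n}` with the Koszul-sign action of `σ`: on the component of
degrees `f` it is `(-1)^{Q_σ(f)}` times permuting the factors by `σ` composed with
applying `φ` factor-wise; taking `φ = id` gives the Koszul-sign action itself. -/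
noncomputable def koszPhi {n : ℕ} (σ : Equiv.Perm (Fin n)) (φ : ∀ i, V i →ₗ[k] V i) :
    GT k V n →ₗ[k] GT k V n :=
  DirectSum.toModule k (Fin n → ℕ) (GT k V n) fun f =>
    (DirectSum.lof k (Fin n → ℕ) (fun f => PiTensorProduct k fun j => V (f j)) (f ∘ ⇑σ⁻¹)) ∘ₗ
      (((-1 : k) ^ Qnum σ f) •
        ((PiTensorProduct.reindex k (fun j => V (f j)) σ).toLinearMap ∘ₗ
          PiTensorProduct.map fun j => φ (f j)))

/-- `φ^{⊗n}` on `V^{⊗n}`. -/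
noncomputable def mapT {n : ℕ} (φ : ∀ i, V i →ₗ[k] V i) : GT k V n →ₗ[k] GT k V n :=
  DirectSum.toModule k (Fin n → ℕ) (GT k V n) fun f =>
    (DirectSum.lof k (Fin n → ℕ) (fun f => PiTensorProduct k fun j => V (f j)) f) ∘ₗ
      PiTensorProduct.map fun j => φ (f j)

/-- The degree-`r` graded piece `(V^{⊗n})_r = ⊕_{f, Σf = r} V (f 1) ⊗ ⋯ ⊗ V (f n)`. -/
abbrev GTpiece (n r : ℕ) : Type _ :=
  ⨁ f : {f : Fin n → ℕ // ∑ j, f j = r}, PiTensorProduct k fun j => V (f.1 j)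

noncomputable def pieceIncl (n r : ℕ) : GTpiece k V n r →ₗ[k] GT k V n :=
  DirectSum.toModule k _ (GT k V n) fun f =>
    DirectSum.lof k (Fin n → ℕ) (fun f => PiTensorProduct k fun j => V (f j)) f.1

noncomputable def pieceProj (n r : ℕ) : GT k V n →ₗ[k] GTpiece k V n r :=
  DirectSum.toModule k _ (GTpiece k V n r) fun f =>
    if h : (∑ j, f j) = r then
      DirectSum.lof k {f : Fin n → ℕ // ∑ j, f j = r}
        (fun f => PiTensorProduct k fun j => V (f.1 j)) ⟨f, h⟩
    else 0

/-- The degree-`r` component of a grading-preserving endomorphism `Ψ` of `V^{⊗n}`. -/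
noncomputable def pieceEndo (n r : ℕ) (Ψ : GT k V n →ₗ[k] GT k V n) :
    GTpiece k V n r →ₗ[k] GTpiece k V n r :=
  pieceProj k V n r ∘ₗ Ψ ∘ₗ pieceIncl k V n r

/-- The Lefschetz series `L_u(Ψ) = Σ_r (-u)^r Tr(Ψ_r)` of a grading-preserving
endomorphism of `V^{⊗n}`, as a power series in `u`. -/
noncomputable def Lser (n : ℕ) (Ψ : GT k V n →ₗ[k] GT k V n) : PowerSeries k :=
  PowerSeries.mk fun r => (-1 : k) ^ r * LinearMap.trace k (GTpiece k V n r) (pieceEndo k V n r Ψ)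

/-- `L_{u^e}(φ^e) = Σ_i (-u^e)^i Tr(φ_i^e)` as a power series in `u`. -/
noncomputable def Lpow (φ : ∀ i, V i →ₗ[k] V i) (e : ℕ) : PowerSeries k :=
  PowerSeries.mk fun m =>
    if e ∣ m then (-1 : k) ^ (m / e) * LinearMap.trace k (V (m / e)) ((φ (m / e)) ^ e) else 0

open Matrix in
theorem sum_path_eq_trace {B R : Type*} [Fintype B] [DecidableEq B] [CommRing R]
    (M N : Matrix B B R) (m : ℕ) :
    ∑ p : Fin (m + 1) → B, (∏ i : Fin m, M (p i.succ) (p i.castSucc)) * N (p 0) (p (Fin.last m)) =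
      trace (M ^ m * N) := by
  induction m generalizing N with
  | zero =>
    rw [pow_zero, one_mul, Matrix.trace, ← (Equiv.funUnique (Fin 1) B).symm.sum_comp]
    simp
  | succ m ih =>
    rw [pow_succ, mul_assoc, ← ih (M * N), ← (Fin.consEquiv fun _ => B).sum_comp,
      Fintype.sum_prod_type, Finset.sum_comm]
    refine Finset.sum_congr rfl fun p _ => ?_
    simp only [Fin.consEquiv_apply, Fin.prod_univ_succ, Fin.cons_succ, Fin.castSucc_zero,
      Fin.cons_zero, Fin.castSucc_succ, Matrix.mul_apply, Finset.mul_sum, ← Fin.succ_last]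
    exact Finset.sum_congr rfl fun a _ => by ring

open Matrix in
theorem sum_cycle_eq_sum_pow {B R : Type*} [Fintype B] [DecidableEq B] [CommRing R]
    (M : Matrix B B R) (w : B → R) (m : ℕ) :
    ∑ p : Fin (m + 1) → B, w (p 0) * ∏ i, M (p (finRotate _ i)) (p i) =
      ∑ b, w b * (M ^ (m + 1)) b b := by
  have h := sum_path_eq_trace M (diagonal w * M) m
  rw [trace_mul_comm, mul_assoc, ← pow_succ'] at h
  simp only [Matrix.trace, diag_apply, diagonal_mul] at h
  rw [← h]
  refine Finset.sum_congr rfl fun p _ => ?_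
  rw [Fin.prod_univ_castSucc, finRotate_last]
  simp only [finRotate_apply, Fin.coeSucc_eq_succ]
  ring

theorem Equiv.Perm.exists_equiv_finRotate {β : Type*} [Fintype β] (τ : Equiv.Perm β) (x : β)
    (h : ∀ y z, τ.SameCycle y z) {m : ℕ} (hm : Fintype.card β = m + 1) :
    ∃ e : Fin (m + 1) ≃ β, e 0 = x ∧ ∀ i, e (finRotate _ i) = τ (e i) := by
  have hc : τ.IsCycleOn ((Finset.univ : Finset β) : Set β) :=
    ⟨by simp [Set.bijOn_univ], fun y _ z _ => h y z⟩
  have hsurj : Function.Surjective fun i : Fin (m + 1) => (τ ^ (i : ℕ)) x := by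
    intro y
    obtain ⟨i, hi, rfl⟩ := hc.exists_pow_eq (Finset.mem_univ x) (Finset.mem_univ y)
    exact ⟨⟨i, by simpa [hm] using hi⟩, rfl⟩
  refine ⟨Equiv.ofBijective _
    ((Fintype.bijective_iff_surjective_and_card _).2 ⟨hsurj, by simp [hm]⟩), by simp, fun i => ?_⟩
  have hp := hc.pow_card_apply (Finset.mem_univ x)
  rw [Finset.card_univ, hm] at hp
  simp only [Equiv.ofBijective_apply, ← Equiv.Perm.mul_apply, ← pow_succ']
  rw [coe_finRotate]
  split_ifs with hi
  · subst hi
    simpa using hp.symm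
  · rfl

theorem sum_transitive_eq_sum_pow {B R β : Type*} [Fintype B] [DecidableEq B] [CommRing R]
    [Fintype β] [DecidableEq β] (τ : Equiv.Perm β) (x : β) (h : ∀ y z, τ.SameCycle y z)
    (M : Matrix B B R) (w : B → R) :
    ∑ p : β → B, w (p x) * ∏ i, M (p (τ i)) (p i) =
      ∑ b, w b * (M ^ Fintype.card β) b b := by
  obtain ⟨m, hm⟩ := Nat.exists_eq_succ_of_ne_zero (Fintype.card_pos_iff.2 ⟨x⟩).ne'
  obtain ⟨e, rfl, he⟩ := τ.exists_equiv_finRotate x h hm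
  rw [hm, ← sum_cycle_eq_sum_pow, ← (e.arrowCongr (Equiv.refl B)).sum_comp]
  refine Finset.sum_congr rfl fun p _ => ?_
  rw [← e.prod_comp]
  simp [← he]

theorem Equiv.Perm.sign_of_transitive {β : Type*} [Fintype β] [DecidableEq β] (τ : Equiv.Perm β)
    (x : β) (h : ∀ y z, τ.SameCycle y z) :
    τ.sign = (-1) ^ (Fintype.card β - 1) := by
  obtain ⟨m, hm⟩ := Nat.exists_eq_succ_of_ne_zero (Fintype.card_pos_iff.2 ⟨x⟩).ne'
  obtain ⟨e, -, he⟩ := τ.exists_equiv_finRotate x h hm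
  rw [← Equiv.Perm.sign_eq_sign_of_equiv _ _ e he, sign_finRotate, hm]

theorem Equiv.Perm.sign_eq_prod_fiber {α ι : Type*} [Fintype α] [DecidableEq α] [Fintype ι]
    [DecidableEq ι] (κ : α → ι) (σ : Equiv.Perm α) (hκ : ∀ a, κ (σ a) = κ a) :
    σ.sign = ∏ i, (σ.subtypePerm (p := fun a => κ a = i) fun a => by rw [hκ]).sign := by
  let _ : LinearOrder ι := LinearOrder.lift' (Fintype.equivFin ι) (Fintype.equivFin ι).injective
  have hM : (σ.permMatrix ℤ).BlockTriangular κ := by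
    intro a b hab
    have : σ a ≠ b := by rintro rfl; simp [hκ] at hab
    simp [Equiv.Perm.permMatrix, PEquiv.toMatrix_apply, this]
  have h := hM.det_fintype
  rw [Matrix.det_permutation] at h
  apply Units.ext
  rw [Units.coe_prod]
  refine h.trans (Finset.prod_congr rfl fun i _ => ?_)
  have hi := Matrix.det_permutation (R := ℤ)
    (σ.subtypePerm (p := fun a => κ a = i) fun a => by rw [hκ])
  rw [Int.cast_id] at hi
  rw [← hi]
  congr 1
  ext a b
  simp [Matrix.toSquareBlock, Matrix.toSquareBlockProp, PEquiv.toMatrix_apply, Subtype.ext_iff]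

theorem sum_prod_fiber {α ι B R : Type*} [Fintype α] [DecidableEq α] [Fintype ι] [DecidableEq ι]
    [Fintype B] [CommRing R] (κ : α → ι) (G : ∀ i, ({a // κ a = i} → B) → R) :
    ∑ p : α → B, ∏ i, G i (fun a => p a) = ∏ i, ∑ q, G i q := by
  rw [Fintype.prod_sum]
  let e : (α → B) ≃ (∀ i, {a // κ a = i} → B) :=
    ((Equiv.sigmaFiberEquiv κ).symm.arrowCongr (Equiv.refl B)).trans
      (Equiv.piCurry fun i (_ : {a // κ a = i}) => B)
  rw [← e.sum_comp]
  rfl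

theorem Equiv.Perm.sign_subtypePerm_fin {n : ℕ} (σ : Equiv.Perm (Fin n)) (S : Fin n → Prop)
    [DecidablePred S] (h : ∀ x, S (σ x) ↔ S x) :
    (σ.subtypePerm h).sign =
      ∏ p ∈ Finset.univ.filter (fun p : Fin n × Fin n => p.1 < p.2 ∧ σ p.2 < σ p.1),
        if S p.1 ∧ S p.2 then -1 else 1 := by
  let e := Fintype.orderIsoFinOfCardEq {x // S x} rfl
  rw [← Equiv.Perm.sign_eq_sign_of_equiv (e.toEquiv.symm.permCongr (σ.subtypePerm h))
    (σ.subtypePerm h) e.toEquiv (by intro x; simp [Equiv.permCongr_apply]),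
    Equiv.Perm.sign_eq_prod_prod_Iio]
  have hL : ∀ j i, (if i < j then
      if (e.toEquiv.symm.permCongr (σ.subtypePerm h)) i <
        (e.toEquiv.symm.permCongr (σ.subtypePerm h)) j then 1 else -1 else 1 : ℤˣ) =
      if (e i).1 < (e j).1 ∧ σ (e j).1 < σ (e i).1 then -1 else 1 := by
    intro j i
    have h1 : (e.toEquiv.symm.permCongr (σ.subtypePerm h)) i <
        (e.toEquiv.symm.permCongr (σ.subtypePerm h)) j ↔ σ (e i).1 < σ (e j).1 := by
      simp only [Equiv.permCongr_apply]
      exact e.symm.lt_iff_lt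
    have h2 : i < j ↔ (e i).1 < (e j).1 := e.lt_iff_lt.symm
    have h3 : (e i).1 < (e j).1 → σ (e i).1 ≠ σ (e j).1 := fun hl he => hl.ne (σ.injective he)
    simp only [h1, h2]
    split_ifs <;> grind
  have hF : ∀ j, ∏ i ∈ Finset.Iio j, (if (e.toEquiv.symm.permCongr (σ.subtypePerm h)) i <
        (e.toEquiv.symm.permCongr (σ.subtypePerm h)) j then 1 else -1 : ℤˣ) =
      ∏ x : {x // S x}, if x.1 < (e j).1 ∧ σ (e j).1 < σ x.1 then -1 else 1 := by
    intro j
    rw [← e.toEquiv.prod_comp]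
    simp only [RelIso.coe_fn_toEquiv, ← hL]
    rw [← Finset.prod_filter]
    congr 1
    ext i
    simp
  refine (Finset.prod_congr rfl fun j _ => hF j).trans ?_
  refine (e.toEquiv.prod_comp fun y : {x // S x} =>
    ∏ x : {x // S x}, if x.1 < y.1 ∧ σ y.1 < σ x.1 then -1 else 1).trans ?_
  rw [Finset.prod_filter, Fintype.prod_prod_type_right,
    ← Finset.prod_subtype (Finset.univ.filter S) (by simp)
      (fun y => ∏ x : {x // S x}, if x.1 < y ∧ σ y < σ x.1 then -1 else 1), Finset.prod_filter]
  refine Finset.prod_congr rfl fun y _ => ?_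
  rw [← Finset.prod_subtype (Finset.univ.filter S) (by simp)
      (fun x => if x < y ∧ σ y < σ x then -1 else 1), Finset.prod_filter]
  by_cases hy : S y
  · simp only [hy, if_true, and_true]
    exact Finset.prod_congr rfl fun x _ => by split_ifs <;> rfl
  · simp [hy]

theorem neg_one_pow_Qnum {n : ℕ} (σ : Equiv.Perm (Fin n)) (f : Fin n → ℕ)
    (h : ∀ x, Odd (f (σ x)) ↔ Odd (f x)) :
    (-1 : ℤˣ) ^ Qnum σ f = (σ.subtypePerm (p := fun x => Odd (f x)) h).sign := by
  rw [Equiv.Perm.sign_subtypePerm_fin, Qnum, ← Finset.prod_pow_eq_pow_sum]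
  refine Finset.prod_congr rfl fun p _ => ?_
  split_ifs with hp
  · exact (Nat.odd_mul.2 hp).neg_one_pow
  · rw [← Nat.odd_mul, Nat.not_odd_iff_even] at hp
    exact hp.neg_one_pow

theorem Equiv.Perm.sign_subtypePerm_eq_prod_fiber {α ι : Type*} [Fintype α] [DecidableEq α]
    [Fintype ι] [DecidableEq ι] (κ : α → ι) (σ : Equiv.Perm α) (hκ : ∀ a, κ (σ a) = κ a)
    (S : ι → Prop) [DecidablePred S] (h : ∀ x, S (κ (σ x)) ↔ S (κ x)) :
    (σ.subtypePerm (p := fun x => S (κ x)) h).sign =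
      ∏ i, if S i then (σ.subtypePerm (p := fun a => κ a = i) fun a => by rw [hκ]).sign else 1 := by
  set τ := Equiv.Perm.ofSubtype (σ.subtypePerm (p := fun x => S (κ x)) h) with hτ
  have h1 : ∀ a, S (κ a) → τ a = σ a := fun a ha => by
    rw [hτ, Equiv.Perm.ofSubtype_apply_of_mem (p := fun x => S (κ x)) _ ha]; rfl
  have h2 : ∀ a, ¬ S (κ a) → τ a = a := fun a ha =>
    Equiv.Perm.ofSubtype_apply_of_not_mem (p := fun x => S (κ x)) _ ha
  have hκτ : ∀ a, κ (τ a) = κ a := fun a => by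
    by_cases ha : S (κ a)
    · rw [h1 a ha, hκ]
    · rw [h2 a ha]
  rw [← Equiv.Perm.sign_ofSubtype, ← hτ, Equiv.Perm.sign_eq_prod_fiber κ τ hκτ]
  refine Finset.prod_congr rfl fun i _ => ?_
  split_ifs with hi
  · congr 1
    ext a
    exact h1 a (by rwa [a.2])
  · refine Eq.trans (congrArg Equiv.Perm.sign ?_) Equiv.Perm.sign_one
    ext a
    exact h2 a (by rwa [a.2])

theorem sum_koszul_eq_prod {B R ι : Type*} [Fintype B] [DecidableEq B] [CommRing R]
    [Fintype ι] [DecidableEq ι] {n : ℕ} (σ : Equiv.Perm (Fin n)) (κ : Fin n → ι)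
    (hκ : ∀ a, κ (σ a) = κ a) (hsurj : Function.Surjective κ)
    (hc : ∀ a b, κ a = κ b → σ.SameCycle a b) (deg : B → ℕ) (M : Matrix B B R)
    (hM : ∀ b c, deg b ≠ deg c → M b c = 0) :
    ∑ p : Fin n → B, (-1) ^ Qnum σ (fun j => deg (p j)) * ∏ j, M (p (σ j)) (p j) =
      ∏ i, ∑ b, (-1) ^ (deg b * (Fintype.card {a // κ a = i} - 1)) *
        (M ^ Fintype.card {a // κ a = i}) b b := by
  obtain ⟨ρ, hρ⟩ := hsurj.hasRightInverse
  have ht : ∀ i, ∀ y z : {a // κ a = i},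
      (σ.subtypePerm (p := fun a => κ a = i) fun a => by rw [hκ]).SameCycle y z := by
    intro i y z
    rw [Equiv.Perm.sameCycle_subtypePerm]
    exact hc _ _ (y.2.trans z.2.symm)
  have hi : ∀ i, ∑ b, (-1) ^ (deg b * (Fintype.card {a // κ a = i} - 1)) *
      (M ^ Fintype.card {a // κ a = i}) b b = _ := fun i =>
    (sum_transitive_eq_sum_pow _ (⟨ρ i, hρ i⟩ : {a // κ a = i}) (ht i) M
      fun b => (-1) ^ (deg b * (Fintype.card {a // κ a = i} - 1))).symm
  rw [Finset.prod_congr rfl fun i _ => hi i, ← sum_prod_fiber]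
  refine Finset.sum_congr rfl fun p _ => ?_
  rw [Finset.prod_mul_distrib]
  have hprod : ∏ j, M (p (σ j)) (p j) = ∏ i, ∏ a : {a // κ a = i}, M (p (σ a)) (p a) :=
    (Fintype.prod_fiberwise κ _).symm
  by_cases hp : ∀ j, deg (p (σ j)) = deg (p j)
  · refine congrArg₂ _ ?_ hprod
    have hpκ : ∀ a, deg (p (ρ (κ a))) = deg (p a) := by
      intro a
      obtain ⟨z, hz⟩ := hc (ρ (κ a)) a (hρ _)
      have : ∀ m : ℕ, ∀ x, deg (p ((σ ^ m) x)) = deg (p x) := by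
        intro m
        induction m with
        | zero => simp
        | succ m ih => intro x; rw [pow_succ', Equiv.Perm.mul_apply, hp, ih]
      obtain ⟨m, rfl | rfl⟩ := z.eq_nat_or_neg
      · rw [← this m (ρ (κ a)), ← zpow_natCast, hz]
      · rw [zpow_neg, zpow_natCast, Equiv.Perm.inv_eq_iff_eq] at hz
        rw [hz, this]
    have hQ := neg_one_pow_Qnum σ (fun j => deg (p (ρ (κ j)))) fun x => by rw [hκ]
    rw [Equiv.Perm.sign_subtypePerm_eq_prod_fiber κ σ hκ fun i => Odd (deg (p (ρ i)))] at hQ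
    simp only [hpκ] at hQ
    have hQ' := congrArg (fun u : ℤˣ => ((u : ℤ) : R)) hQ
    push_cast at hQ'
    rw [hQ']
    refine Finset.prod_congr rfl fun i _ => ?_
    rw [Equiv.Perm.sign_of_transitive _ ⟨ρ i, hρ i⟩ (ht i), pow_mul]
    split_ifs with ho
    · simp [ho.neg_one_pow]
    · simp [(Nat.not_odd_iff_even.1 ho).neg_one_pow]
  · push Not at hp
    obtain ⟨j, hj⟩ := hp
    have h0 : ∏ j, M (p (σ j)) (p j) = 0 := Finset.prod_eq_zero (Finset.mem_univ j) (hM _ _ hj)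
    rw [h0, mul_zero]
    exact (mul_eq_zero_of_right _ (hprod.symm.trans h0)).symm

theorem Equiv.Perm.exists_cycle_index {n : ℕ} (σ : Equiv.Perm (Fin n)) :
    ∃ κ : Fin n → {x // σ x = x} ⊕ σ.cycleFactorsFinset,
      (∀ a, κ (σ a) = κ a) ∧ Function.Surjective κ ∧ (∀ a b, κ a = κ b → σ.SameCycle a b) ∧
      (∀ x, Fintype.card {a // κ a = Sum.inl x} = 1) ∧
      ∀ c, Fintype.card {a // κ a = Sum.inr c} = c.1.support.card := by
  let κ : Fin n → {x // σ x = x} ⊕ σ.cycleFactorsFinset := fun a =>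
    if h : σ a = a then Sum.inl ⟨a, h⟩
    else Sum.inr ⟨σ.cycleOf a, Equiv.Perm.cycleOf_mem_cycleFactorsFinset_iff.2
      (Equiv.Perm.mem_support.2 h)⟩
  have hfix : ∀ a (h : σ a = a), κ a = Sum.inl ⟨a, h⟩ := fun a h => dif_pos h
  have hmov : ∀ a (h : σ a ≠ a), κ a = Sum.inr ⟨σ.cycleOf a,
    Equiv.Perm.cycleOf_mem_cycleFactorsFinset_iff.2 (Equiv.Perm.mem_support.2 h)⟩ :=
    fun a h => dif_neg h
  have hl : ∀ a x, κ a = Sum.inl x ↔ a = x.1 := by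
    intro a x
    by_cases h : σ a = a
    · rw [hfix a h, Sum.inl.injEq, Subtype.ext_iff]
    · rw [hmov a h]
      refine iff_of_false (by simp) ?_
      rintro rfl
      exact h x.2
  have hr : ∀ a c, κ a = Sum.inr c ↔ a ∈ c.1.support := by
    intro a c
    by_cases h : σ a = a
    · rw [hfix a h]
      refine iff_of_false (by simp) fun hc => ?_
      exact Equiv.Perm.mem_support.1 (Equiv.Perm.mem_cycleFactorsFinset_support_le c.2 hc) h
    · rw [hmov a h, Sum.inr.injEq, Subtype.ext_iff, eq_comm,
        Equiv.Perm.eq_cycleOf_of_mem_cycleFactorsFinset_iff σ c c.2]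
  refine ⟨κ, fun a => ?_, ?_, fun a b hab => ?_, fun x => ?_, fun c => ?_⟩
  · by_cases h : σ a = a
    · rw [h]
    · rw [hmov a h, hr]
      simp [h]
  · rintro (x | c)
    · exact ⟨x, (hl _ _).2 rfl⟩
    · obtain ⟨a, ha⟩ := (Equiv.Perm.mem_cycleFactorsFinset_iff.1 c.2).1.nonempty_support
      exact ⟨a, (hr _ _).2 ha⟩
  · by_cases h : σ b = b
    · rw [hfix b h, hl] at hab
      rw [hab]
    · rw [hmov b h, hr] at hab
      exact (Equiv.Perm.mem_support_cycleOf_iff.1 hab).1.symm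
  · simp [hl]
  · rw [Fintype.card_subtype]
    simp only [hr, Finset.filter_univ_mem]

theorem prod_cycle_index {n : ℕ} (σ : Equiv.Perm (Fin n)) {R : Type*} [CommMonoid R] (L : ℕ → R) :
    (∏ _x : {x // σ x = x}, L 1) * ∏ c : σ.cycleFactorsFinset, L c.1.support.card =
      ∏ r ∈ Finset.range n, L (r + 1) ^ cycleCount σ (r + 1) := by
  have hprod : ∏ c : σ.cycleFactorsFinset, L c.1.support.card = (σ.cycleType.map L).prod := by
    rw [Equiv.Perm.cycleType_def, Multiset.map_map]
    exact Finset.prod_coe_sort _ fun c : Equiv.Perm (Fin n) => L c.support.card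
  have hone : σ.cycleType.count 1 = 0 :=
    Multiset.count_eq_zero.2 fun h => (Equiv.Perm.one_lt_of_mem_cycleType h).false
  have hsub : σ.cycleType.toFinset ⊆ (Finset.range n).map (addRightEmbedding 1) := by
    intro r hr
    rw [Multiset.mem_toFinset] at hr
    have h1 := Equiv.Perm.one_lt_of_mem_cycleType hr
    have h2 := (Equiv.Perm.le_card_support_of_mem_cycleType hr).trans (Finset.card_le_univ _)
    simp only [Fintype.card_fin] at h2
    simp only [Finset.mem_map, Finset.mem_range, addRightEmbedding_apply]
    exact ⟨r - 1, by lia, by lia⟩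
  rw [hprod, Finset.prod_multiset_map_count, Finset.prod_subset hsub (by
    intro r _ hr
    rw [Multiset.mem_toFinset] at hr
    simp [hr]), Finset.prod_map]
  cases n with
  | zero => simp
  | succ n =>
    rw [Finset.prod_range_succ', Finset.prod_range_succ']
    simp [cycleCount, hone, Fintype.card_subtype, mul_comm]

theorem DFinsupp.basis_apply {ι R : Type*} {M : ι → Type*} {η : ι → Type*} [DecidableEq ι]
    [Semiring R] [∀ i, AddCommMonoid (M i)] [∀ i, Module R (M i)]
    (b : ∀ i, Module.Basis (η i) R (M i)) (p : Σ i, η i) :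
    DFinsupp.basis b p = DFinsupp.single p.1 (b p.1 p.2) := by
  apply (DFinsupp.basis b).repr.injective
  rw [Module.Basis.repr_self]
  ext q
  change _ = (b q.1).repr (DFinsupp.single p.1 (b p.1 p.2) q.1) q.2
  obtain ⟨i, x⟩ := p
  obtain ⟨j, y⟩ := q
  by_cases h : i = j
  · subst h
    by_cases hxy : x = y <;> simp [hxy]
  · rw [DFinsupp.single_eq_of_ne (Ne.symm h), map_zero, Finsupp.zero_apply,
      Finsupp.single_eq_of_ne (by simp [Ne.symm h])]

section Bases

variable {k V} {η : ℕ → Type*} (b : ∀ i, Module.Basis (η i) k (V i)) (φ : ∀ i, V i →ₗ[k] V i)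

/-- The matrix of `⨁ i, φ i` in the basis of `⨁ i, V i` assembled from the bases `b i`. -/
noncomputable def gradedMatrix : Matrix (Σ i, η i) (Σ i, η i) k := fun p q =>
  (b p.1).repr (DirectSum.lof k ℕ V q.1 (φ q.1 (b q.1 q.2)) p.1) p.2

theorem gradedMatrix_of_ne {p q : Σ i, η i} (h : p.1 ≠ q.1) : gradedMatrix b φ p q = 0 := by
  simp [gradedMatrix, DirectSum.lof_eq_of, DirectSum.of_eq_of_ne _ _ _ h]

theorem gradedMatrix_pow [Fintype (Σ i, η i)] [DecidableEq (Σ i, η i)] (m : ℕ) :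
    gradedMatrix b φ ^ m = gradedMatrix b fun i => φ i ^ m := by
  let W : Module.Basis (Σ i, η i) k (⨁ i, V i) := DFinsupp.basis b
  have hW : ∀ p, W p = DirectSum.lof k ℕ V p.1 (b p.1 p.2) := fun p =>
    DFinsupp.basis_apply b p
  have hm : ∀ ψ : ∀ i, V i →ₗ[k] V i,
      gradedMatrix b ψ = LinearMap.toMatrix W W (DirectSum.lmap ψ) := by
    intro ψ
    ext p q
    rw [LinearMap.toMatrix_apply, hW, DirectSum.lmap_lof]
    rfl
  rw [hm, hm, LinearMap.toMatrix_pow]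
  congr 1
  induction m with
  | zero => ext; simp
  | succ m ih => rw [pow_succ, ih]; ext; simp [pow_succ]

theorem sum_gradedMatrix_diag [Fintype (Σ i, η i)] (i : ℕ) :
    ∑ p : Σ i, η i, (if p.1 = i then gradedMatrix b φ p p else 0) =
      LinearMap.trace k (V i) (φ i) := by
  classical
  have : Finite (η i) := Finite.of_injective (Sigma.mk i) sigma_mk_injective
  have := Fintype.ofFinite (η i)
  have hf : Finset.univ.filter (fun p : Σ i, η i => p.1 = i) =
      Finset.univ.map (Function.Embedding.sigmaMk i) := by
    ext ⟨j, x⟩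
    simp only [Finset.mem_filter, Finset.mem_univ, true_and, Finset.mem_map,
      Function.Embedding.sigmaMk_apply]
    constructor
    · rintro rfl
      exact ⟨x, rfl⟩
    · rintro ⟨y, hy⟩
      exact (congrArg Sigma.fst hy).symm
  rw [← Finset.sum_filter, hf, Finset.sum_map, LinearMap.trace_eq_matrix_trace k (b i),
    Matrix.trace]
  simp [gradedMatrix, LinearMap.toMatrix_apply, DirectSum.lof_apply]
  rfl

/-- The matrix of `⨁ i, φ i` with the column of a basis vector of degree `i` scaled by
`(-u) ^ i`. -/
noncomputable def lefschetzMatrix : Matrix (Σ i, η i) (Σ i, η i) (PowerSeries k) := fun p q =>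
  (-PowerSeries.X) ^ q.1 * PowerSeries.C (gradedMatrix b φ p q)

theorem lefschetzMatrix_pow [Fintype (Σ i, η i)] [DecidableEq (Σ i, η i)] (m : ℕ)
    (p q : Σ i, η i) :
    (lefschetzMatrix b φ ^ m) p q =
      (-PowerSeries.X) ^ (m * q.1) * PowerSeries.C ((gradedMatrix b φ ^ m) p q) := by
  induction m generalizing q with
  | zero => by_cases h : p = q <;> simp [h]
  | succ m ih =>
    rw [pow_succ, pow_succ, Matrix.mul_apply, Matrix.mul_apply, map_sum, Finset.mul_sum]
    refine Finset.sum_congr rfl fun c _ => ?_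
    rw [ih, lefschetzMatrix, map_mul]
    by_cases h : c.1 = q.1
    · rw [h]
      ring
    · simp [gradedMatrix_of_ne b φ h]

theorem coeff_neg_one_pow_mul_neg_X_pow (r s Q : ℕ) (a : k) :
    PowerSeries.coeff r ((-1) ^ Q * ((-PowerSeries.X) ^ s * PowerSeries.C a)) =
      if s = r then (-1) ^ r * ((-1) ^ Q * a) else 0 := by
  have h : ((-1) ^ Q * ((-PowerSeries.X) ^ s * PowerSeries.C a) : PowerSeries k) =
      PowerSeries.C ((-1) ^ s * ((-1) ^ Q * a)) * PowerSeries.X ^ s := by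
    rw [neg_pow PowerSeries.X]
    simp only [map_mul, map_pow, map_neg, map_one]
    ring
  rw [h, PowerSeries.coeff_C_mul, PowerSeries.coeff_X_pow]
  split_ifs with h1 h2 h2
  · rw [h1, mul_one]
  · exact absurd h1.symm h2
  · exact absurd h2.symm h1
  · rw [mul_zero]

theorem sum_lefschetzMatrix_pow_diag [Fintype (Σ i, η i)] [DecidableEq (Σ i, η i)] {m : ℕ}
    (hm : m ≠ 0) :
    ∑ p : Σ i, η i, (-1) ^ (p.1 * (m - 1)) * (lefschetzMatrix b φ ^ m) p p = Lpow k V φ m := by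
  ext t
  simp only [map_sum, lefschetzMatrix_pow, coeff_neg_one_pow_mul_neg_X_pow, Lpow,
    PowerSeries.coeff_mk]
  split_ifs with h
  · obtain ⟨i, rfl⟩ := h
    suffices H : ∀ j, j = i → _ = (-1) ^ j * LinearMap.trace k (V j) (φ j ^ m) from
      H _ (Nat.mul_div_cancel_left _ (Nat.pos_of_ne_zero hm))
    rintro j rfl
    rw [← sum_gradedMatrix_diag b (fun i => φ i ^ m), Finset.mul_sum, ← gradedMatrix_pow]
    refine Finset.sum_congr rfl fun p _ => ?_
    simp only [Nat.mul_right_inj hm]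
    split_ifs with hp
    · subst hp
      obtain ⟨l, rfl⟩ := Nat.exists_eq_succ_of_ne_zero hm
      rw [← mul_assoc, ← pow_add]
      congr 1
      rw [neg_one_pow_congr]
      simp only [Nat.succ_eq_add_one, Nat.add_sub_cancel, Nat.even_add, Nat.even_mul]
      grind
    · simp
  · exact Finset.sum_eq_zero fun p _ => if_neg fun hp => h ⟨_, hp.symm⟩

/-- Bases of the pieces `V i` give a basis of each graded piece of the tensor power. -/
noncomputable def pieceBasis (n r : ℕ) :
    Module.Basis {p : Fin n → Σ i, η i // ∑ j, (p j).1 = r} k (GTpiece k V n r) :=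
  Module.Basis.reindex
    (DFinsupp.basis (M := fun f : {f : Fin n → ℕ // ∑ j, f j = r} =>
      PiTensorProduct k fun j => V (f.1 j)) fun f => Basis.piTensorProduct fun j => b (f.1 j))
    { toFun := fun x => ⟨fun j => ⟨x.1.1 j, x.2 j⟩, x.1.2⟩
      invFun := fun p => ⟨⟨fun j => (p.1 j).1, p.2⟩, fun j => (p.1 j).2⟩
      left_inv := fun _ => rfl
      right_inv := fun _ => rfl }

theorem pieceBasis_apply (n r : ℕ) (p : {p : Fin n → Σ i, η i // ∑ j, (p j).1 = r}) :
    pieceBasis b n r p = DirectSum.lof k _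
      (fun f : {f : Fin n → ℕ // ∑ j, f j = r} => PiTensorProduct k fun j => V (f.1 j))
      ⟨fun j => (p.1 j).1, p.2⟩ (PiTensorProduct.tprod k fun j => b (p.1 j).1 (p.1 j).2) := by
  rw [pieceBasis, Module.Basis.reindex_apply, DFinsupp.basis_apply, Basis.piTensorProduct_apply]
  rfl

theorem pieceBasis_repr_lof_tprod (n r : ℕ) (p : {p : Fin n → Σ i, η i // ∑ j, (p j).1 = r})
    (g : {f : Fin n → ℕ // ∑ j, f j = r}) (v : ∀ j, V (g.1 j)) :
    (pieceBasis b n r).repr (DirectSum.lof k _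
      (fun f : {f : Fin n → ℕ // ∑ j, f j = r} => PiTensorProduct k fun j => V (f.1 j))
      g (PiTensorProduct.tprod k v)) p =
      ∏ j, (b (p.1 j).1).repr (DirectSum.lof k ℕ V (g.1 j) (v j) (p.1 j).1) (p.1 j).2 := by
  change (Basis.piTensorProduct fun j => b (p.1 j).1).repr ((DirectSum.lof k _
      (fun f : {f : Fin n → ℕ // ∑ j, f j = r} => PiTensorProduct k fun j => V (f.1 j))
      g (PiTensorProduct.tprod k v)) ⟨fun j => (p.1 j).1, p.2⟩) (fun j => (p.1 j).2) = _
  by_cases h : g = ⟨fun j => (p.1 j).1, p.2⟩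
  · subst h
    rw [DirectSum.lof_apply, Basis.piTensorProduct_repr_tprod_apply]
    exact Finset.prod_congr rfl fun j _ => by rw [DirectSum.lof_apply]
  · rw [DirectSum.lof_eq_of, DirectSum.of_eq_of_ne _ _ _ (Ne.symm h), map_zero, Finsupp.zero_apply]
    obtain ⟨j, hj⟩ : ∃ j, (p.1 j).1 ≠ g.1 j := by
      by_contra! hg
      exact h (Subtype.ext (funext fun j => (hg j).symm))
    refine (Finset.prod_eq_zero (Finset.mem_univ j) ?_).symm
    rw [DirectSum.lof_eq_of, DirectSum.of_eq_of_ne _ _ _ hj, map_zero, Finsupp.zero_apply]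

theorem trace_pieceEndo_koszPhi [Fintype (Σ i, η i)] {n : ℕ} (σ : Equiv.Perm (Fin n)) (r : ℕ) :
    LinearMap.trace k (GTpiece k V n r) (pieceEndo k V n r (koszPhi k V σ φ)) =
      ∑ p : Fin n → Σ i, η i, if ∑ j, (p j).1 = r then
        (-1) ^ Qnum σ (fun j => (p j).1) * ∏ j, gradedMatrix b φ (p (σ j)) (p j) else 0 := by
  classical
  rw [LinearMap.trace_eq_matrix_trace k (pieceBasis b n r), Matrix.trace, ← Finset.sum_filter,
    Finset.sum_subtype (p := fun p : Fin n → Σ i, η i => ∑ j, (p j).1 = r) _ (by simp)]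
  refine Finset.sum_congr rfl fun p _ => ?_
  have hs : ∑ j, ((fun j => (p.1 j).1) ∘ ⇑σ⁻¹) j = r :=
    (Equiv.sum_comp σ⁻¹ fun j => (p.1 j).1).trans p.2
  have hΨ : pieceEndo k V n r (koszPhi k V σ φ) (pieceBasis b n r p) =
      (-1 : k) ^ Qnum σ (fun j => (p.1 j).1) • DirectSum.lof k _
        (fun f : {f : Fin n → ℕ // ∑ j, f j = r} => PiTensorProduct k fun j => V (f.1 j))
        ⟨(fun j => (p.1 j).1) ∘ ⇑σ⁻¹, hs⟩ (PiTensorProduct.tprod k fun j =>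
          φ _ (b (p.1 (σ⁻¹ j)).1 (p.1 (σ⁻¹ j)).2)) := by
    rw [pieceBasis_apply]
    simp only [pieceEndo, pieceIncl, pieceProj, koszPhi, LinearMap.comp_apply,
      DirectSum.toModule_lof, LinearMap.smul_apply, map_smul, LinearEquiv.coe_coe,
      PiTensorProduct.map_tprod, PiTensorProduct.reindex_tprod]
    rw [dif_pos hs]
    rfl
  rw [Matrix.diag_apply, LinearMap.toMatrix_apply, hΨ, map_smul, Finsupp.smul_apply, smul_eq_mul,
    pieceBasis_repr_lof_tprod,
    ← Equiv.prod_comp σ⁻¹ fun j => gradedMatrix b φ (p.1 (σ j)) (p.1 j)]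
  have hσ : ∀ j, σ (σ⁻¹ j) = j := σ.apply_symm_apply
  simp only [hσ]
  rfl

end Bases

/-- Trace formula on `V^{⊗n}`: for a graded endomorphism `φ` of a graded vector space
`V = ⊕_{i≤2d} V_i` with finite-dimensional pieces and any `σ ∈ S_n`, the Lefschetz
series of `σ ∘ φ^{⊗n}` (Koszul-sign action) is
`L_u(σ ∘ φ^{⊗n}) = Π_{r=1}^n L_{u^r}(φ^r)^{m_r(σ)}`. -/
theorem stmt_12 [∀ i, FiniteDimensional k (V i)] (d : ℕ)
    (hV : ∀ i, 2 * d < i → Subsingleton (V i)) {n : ℕ}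
    (φ : ∀ i, V i →ₗ[k] V i) (σ : Equiv.Perm (Fin n)) :
    Lser k V n (koszPhi k V σ φ) =
      ∏ r ∈ Finset.range n, Lpow k V φ (r + 1) ^ cycleCount σ (r + 1) := by
  let b := fun i => Module.finBasis k (V i)
  have hlt : ∀ p : Σ i, Fin (Module.finrank k (V i)), p.1 < 2 * d + 1 := by
    rintro ⟨i, x⟩
    by_contra! hi
    have := hV i (by simpa using hi)
    rw [Module.finrank_zero_of_subsingleton] at x
    exact x.elim0
  have : Finite (Σ i, Fin (Module.finrank k (V i))) := by
    refine Finite.of_injective (β := Σ i : Fin (2 * d + 1), Fin (Module.finrank k (V i)))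
      (fun p => ⟨⟨p.1, hlt p⟩, p.2⟩) ?_
    rintro ⟨i, x⟩ ⟨j, y⟩ h
    simp only [Sigma.mk.injEq, Fin.mk.injEq] at h ⊢
    exact h
  have := Fintype.ofFinite (Σ i, Fin (Module.finrank k (V i)))
  obtain ⟨κ, hκ, hsurj, hc, hl, hr⟩ := σ.exists_cycle_index
  have key := sum_koszul_eq_prod σ κ hκ hsurj hc Sigma.fst (lefschetzMatrix b φ)
    fun p q h => by simp [lefschetzMatrix, gradedMatrix_of_ne b φ h]
  have hL : ∀ i, ∑ p : Σ i, Fin (Module.finrank k (V i)),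
      (-1) ^ (p.1 * (Fintype.card {a // κ a = i} - 1)) *
        (lefschetzMatrix b φ ^ Fintype.card {a // κ a = i}) p p =
      Lpow k V φ (Fintype.card {a // κ a = i}) := fun i => by
    obtain ⟨a, ha⟩ := hsurj i
    exact sum_lefschetzMatrix_pow_diag b φ (Fintype.card_pos_iff.2 ⟨⟨a, ha⟩⟩).ne'
  rw [Finset.prod_congr rfl fun i _ => hL i, Fintype.prod_sum_type] at key
  simp only [hl, hr] at key
  rw [prod_cycle_index σ (Lpow k V φ)] at key
  rw [← key]
  ext r
  rw [Lser, PowerSeries.coeff_mk, trace_pieceEndo_koszPhi b, map_sum, Finset.mul_sum]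
  refine Finset.sum_congr rfl fun p _ => ?_
  simp only [lefschetzMatrix, Finset.prod_mul_distrib, Finset.prod_pow_eq_pow_sum, ← map_prod,
    coeff_neg_one_pow_mul_neg_X_pow, mul_ite, mul_zero]
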